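/- arXiv:1605.06374 — 2 statements merged into one kernel-verified Lean document; each statement's English description precedes it below -/
import Mathlib

section
/- Let X be a compact metric space, g ∈ D_m(I), A ∈ F_0(X), and α ∈ (0,1]. Then [A]_α^g = [A]_{ξ_g(α)}, i.e., {x ∈ supp(A) : g(A(x)) ≥ α} = {x ∈ X : A(x) ≥ ξ_g(α)}. -/
noncomputable section

open Set Metric

/-- The unit interval `I = [0,1]` as a subset of `ℝ`. -/
def I01 : Set ℝ := Set.Icc 0 1

/-- `g ∈ D_m(I)`: `g : I → I` is nondecreasing, right-continuous, `g 0 = 0`, `g 1 = 1`. -/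
def Dm (g : ℝ → ℝ) : Prop :=
  MonotoneOn g I01 ∧
  (∀ x ∈ I01, ContinuousWithinAt g (I01 ∩ Set.Ici x) x) ∧
  Set.MapsTo g I01 I01 ∧ g 0 = 0 ∧ g 1 = 1

/-- `ξ_g x = min g⁻¹([x,1])` (the min exists by right-continuity; `sInf` here). -/
def xiG (g : ℝ → ℝ) (x : ℝ) : ℝ := sInf {t | t ∈ I01 ∧ x ≤ g t}

/-- The `α`-cut `[A]_α` of a fuzzy set `A`. -/
def cut {X : Type*} (A : X → ℝ) (α : ℝ) : Set X := {x | α ≤ A x}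

/-- The support of a fuzzy set. -/
def supp {X : Type*} [TopologicalSpace X] (A : X → ℝ) : Set X := closure {x | 0 < A x}

/-- The `g`-cut `[A]_α^g = {x ∈ supp A : g (A x) ≥ α}`. -/
def gcut {X : Type*} [TopologicalSpace X] (g : ℝ → ℝ) (A : X → ℝ) (α : ℝ) : Set X :=
  {x | x ∈ supp A ∧ α ≤ g (A x)}

/-- `A ∈ F(X)`: an upper semicontinuous fuzzy set on `X`. -/
def IsFuzzy {X : Type*} [TopologicalSpace X] (A : X → ℝ) : Prop :=
  UpperSemicontinuous A ∧ ∀ x, A x ∈ I01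

/-- `A ∈ F_0(X)`: a nonempty (not identically 0) upper semicontinuous fuzzy set. -/
def InF0 {X : Type*} [TopologicalSpace X] (A : X → ℝ) : Prop := IsFuzzy A ∧ ∃ x, A x ≠ 0

/-- `A ∈ F^1(X)`: an upper semicontinuous fuzzy set attaining the value 1. -/
def InF1 {X : Type*} [TopologicalSpace X] (A : X → ℝ) : Prop := IsFuzzy A ∧ ∃ x, 1 ≤ A x

/-- The `g`-fuzzification `f̃_g(A)(x) = sup {g (A y) : y ∈ f⁻¹(x)}` (with `sup ∅ = 0`). -/
def fuzz {X : Type*} (f : X → X) (g : ℝ → ℝ) (A : X → ℝ) : X → ℝ :=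
  fun x => sSup ((fun y => g (A y)) '' (f ⁻¹' {x}))

open Classical in
/-- Hausdorff metric, extended by `d_H(∅,∅) = 0` and `d_H(∅,A) = diam X`. -/
def dH {X : Type*} [MetricSpace X] (A B : Set X) : ℝ :=
  if A = ∅ ∧ B = ∅ then 0
  else if A = ∅ ∨ B = ∅ then Metric.diam (Set.univ : Set X)
  else Metric.hausdorffDist A B

/-- The levelwise metric `d_∞(A,B) = sup {d_H([A]_α, [B]_α) : α ∈ (0,1]}`. -/
def dInfty {X : Type*} [MetricSpace X] (A B : X → ℝ) : ℝ :=
  sSup ((fun α => dH (cut A α) (cut B α)) '' Set.Ioc (0:ℝ) 1)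

/-- `K(X)`: the hyperspace of nonempty compact subsets of `X`. -/
def Kc (X : Type*) [MetricSpace X] : Set (Set X) := {A | IsCompact A ∧ A.Nonempty}

section Dyn

variable {Y : Type*}

/-- `U` is a (relatively) open subset of the space `(S, ρ)`. -/
def IsOpenIn (S : Set Y) (ρ : Y → Y → ℝ) (U : Set Y) : Prop :=
  U ⊆ S ∧ ∀ x ∈ U, ∃ ε > 0, ∀ y ∈ S, ρ x y < ε → y ∈ U

/-- Diameter of a set with respect to the distance function `ρ`. -/
def diamIn (ρ : Y → Y → ℝ) (U : Set Y) : ℝ := sSup (Set.image2 ρ U U)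

/-- Sensitive dependence on initial conditions of `T` on the space `(S, ρ)`. -/
def SensitiveOn (S : Set Y) (ρ : Y → Y → ℝ) (T : Y → Y) : Prop :=
  ∃ δ > 0, ∀ x ∈ S, ∀ ε > 0, ∃ y ∈ S, ρ x y < ε ∧ ∃ n : ℕ, δ < ρ (T^[n] x) (T^[n] y)

/-- `𝓕`-sensitivity of `T` on the space `(S, ρ)`. -/
def FSensitiveOn (S : Set Y) (ρ : Y → Y → ℝ) (T : Y → Y) (F : Set (Set ℕ)) : Prop :=
  ∃ ε > 0, ∀ U : Set Y, IsOpenIn S ρ U → U.Nonempty →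
    {n : ℕ | ε < diamIn ρ (T^[n] '' U)} ∈ F

/-- Multi-sensitivity of `T` on the space `(S, ρ)`. -/
def MultiSensitiveOn (S : Set Y) (ρ : Y → Y → ℝ) (T : Y → Y) : Prop :=
  ∃ ε > 0, ∀ (k : ℕ) (U : Fin k → Set Y),
    (∀ i, IsOpenIn S ρ (U i) ∧ (U i).Nonempty) →
    ∃ n : ℕ, ∀ i, ε < diamIn ρ (T^[n] '' U i)

/-- Topological transitivity of `T` on the space `(S, ρ)`. -/
def TransitiveOn (S : Set Y) (ρ : Y → Y → ℝ) (T : Y → Y) : Prop :=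
  ∀ U V : Set Y, IsOpenIn S ρ U → U.Nonempty → IsOpenIn S ρ V → V.Nonempty →
    ∃ n : ℕ, ((T^[n] '' U) ∩ V).Nonempty

/-- Weak mixing: `T × T` is transitive on `(S × S, max-metric)`. -/
def WeaklyMixingOn (S : Set Y) (ρ : Y → Y → ℝ) (T : Y → Y) : Prop :=
  TransitiveOn (S ×ˢ S) (fun p q => max (ρ p.1 q.1) (ρ p.2 q.2)) (Prod.map T T)

end Dyn

/-- A (proper) Furstenberg family on `ℤ⁺ = ℕ`. -/
def FurstenbergFamily (F : Set (Set ℕ)) : Prop :=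
  (∀ F1 F2 : Set ℕ, F1 ∈ F → F1 ⊆ F2 → F2 ∈ F) ∧ Set.univ ∈ F ∧ ∅ ∉ F

/-- The infimum defining `ξ_g α` is attained, by right-continuity of `g`. -/
theorem isLeast_xiG {g : ℝ → ℝ} (hg : Dm g) {α : ℝ} (hα : α ≤ 1) :
    IsLeast {t | t ∈ I01 ∧ α ≤ g t} (xiG g α) := by
  obtain ⟨-, hcont, -, -, hg1⟩ := hg
  have hbdd : BddBelow {t | t ∈ I01 ∧ α ≤ g t} := ⟨0, fun t ht => ht.1.1⟩
  have hone : (1 : ℝ) ∈ {t | t ∈ I01 ∧ α ≤ g t} := ⟨⟨zero_le_one, le_rfl⟩, hα.trans_eq hg1.symm⟩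
  have hmem : xiG g α ∈ I01 := ⟨le_csInf ⟨1, hone⟩ fun t ht => ht.1.1, csInf_le hbdd hone⟩
  refine ⟨⟨hmem, ?_⟩, fun t ht => csInf_le hbdd ht⟩
  by_contra! hlt
  obtain ⟨ε, hε, hball⟩ := Metric.mem_nhdsWithin_iff.1 ((hcont _ hmem).eventually_lt_const hlt)
  obtain ⟨s, hs, hsε⟩ := exists_lt_of_csInf_lt ⟨1, hone⟩ (lt_add_of_pos_right (xiG g α) hε)
  have hle : xiG g α ≤ s := csInf_le hbdd hs
  have hs_ball : s ∈ Metric.ball (xiG g α) ε := by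
    rw [Metric.mem_ball, Real.dist_eq, abs_of_nonneg (sub_nonneg.2 hle)]
    linarith
  exact absurd hs.2 (not_le.2 (hball ⟨hs_ball, hs.1, hle⟩))

/-- For a compact metric space `X`, `g ∈ D_m(I)`, `A ∈ F_0(X)` and
`α ∈ (0,1]`, one has `[A]_α^g = [A]_{ξ_g α}`. -/
theorem stmt1 {X : Type*} [MetricSpace X] [CompactSpace X]
    (g : ℝ → ℝ) (hg : Dm g) (A : X → ℝ) (hA : InF0 A)
    (α : ℝ) (hα : α ∈ Set.Ioc (0:ℝ) 1) :
    gcut g A α = cut A (xiG g α) := by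
  obtain ⟨⟨hmem, hle⟩, hmin⟩ := isLeast_xiG hg hα.2
  have hpos : 0 < xiG g α := by
    refine lt_of_le_of_ne hmem.1 fun h => ?_
    rw [← h, hg.2.2.2.1] at hle
    exact absurd hα.1 (not_lt.2 hle)
  ext x
  constructor
  · exact fun hx => hmin ⟨hA.1.2 x, hx.2⟩
  · intro hx
    exact ⟨subset_closure (lt_of_lt_of_le hpos hx), hle.trans (hg.1 hmem (hA.1.2 x) hx)⟩
end
end

section
/- Let (X,f) be a dynamical system, g ∈ D_m(I), and f̃_g the g-fuzzification of f. Then for every n ∈ ℕ, every A ∈ F(X), and every α ∈ (0,1], the α-cut of the n-th iterate satisfies [(f̃_g)ⁿ(A)]_α = fⁿ([A]_{ξ_gⁿ(α)}), where ξ_gⁿ denotes the n-fold composition of ξ_g. -/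
noncomputable section

open Set Metric

/-- `ξ_g` is the lower adjoint of `g` on `(0,1]`. -/
theorem Dm.xiG_le_iff {g : ℝ → ℝ} (hg : Dm g) {α t : ℝ} (hα : α ∈ Ioc (0:ℝ) 1)
    (ht : t ∈ I01) : xiG g α ≤ t ↔ α ≤ g t := by
  obtain ⟨hmono, hcont, -, -, hg1⟩ := hg
  have hbdd : BddBelow {s | s ∈ I01 ∧ α ≤ g s} := ⟨0, fun s hs => hs.1.1⟩
  have hone : (1:ℝ) ∈ {s | s ∈ I01 ∧ α ≤ g s} := ⟨⟨zero_le_one, le_rfl⟩, hg1.symm ▸ hα.2⟩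
  refine ⟨fun h => ?_, fun h => csInf_le hbdd ⟨ht, h⟩⟩
  rcases ht.2.eq_or_lt with rfl | ht1
  · exact hone.2
  have hev : ∀ s ∈ Ioc t 1, α ≤ g s := fun s hs => by
    obtain ⟨r, hr, hrs⟩ := exists_lt_of_csInf_lt ⟨1, hone⟩ (h.trans_lt hs.1)
    exact hr.2.trans (hmono hr.1 ⟨ht.1.trans hs.1.le, hs.2⟩ hrs.le)
  have hsub : Ioc t 1 ⊆ I01 ∩ Ici t := fun s hs => ⟨⟨ht.1.trans hs.1.le, hs.2⟩, hs.1.le⟩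
  have hlim := (hcont t ht).mono hsub
  have : (nhdsWithin t (Ioc t 1)).NeBot := by
    rw [nhdsWithin_Ioc_eq_nhdsGT ht1]
    infer_instance
  exact ge_of_tendsto hlim (Filter.eventually_of_mem self_mem_nhdsWithin hev)

theorem Dm.xiG_mem_Ioc {g : ℝ → ℝ} (hg : Dm g) {α : ℝ} (hα : α ∈ Ioc (0:ℝ) 1) :
    xiG g α ∈ Ioc (0:ℝ) 1 := by
  constructor
  · by_contra! h
    have := (hg.xiG_le_iff hα ⟨le_rfl, zero_le_one⟩).1 h
    rw [hg.2.2.2.1] at this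
    exact this.not_gt hα.1
  · exact (hg.xiG_le_iff hα ⟨zero_le_one, le_rfl⟩).2 (hg.2.2.2.2.symm ▸ hα.2)

theorem IsFuzzy.isClosed_cut {X : Type*} [TopologicalSpace X] {A : X → ℝ} (hA : IsFuzzy A)
    (α : ℝ) : IsClosed (cut A α) :=
  upperSemicontinuous_iff_isClosed_preimage.1 hA.1 α

theorem fuzz_mem_I01 {X : Type*} {f : X → X} {g : ℝ → ℝ} {A : X → ℝ}
    (hA : ∀ x, g (A x) ∈ I01) (x : X) : fuzz f g A x ∈ I01 := by
  constructor
  · apply Real.sSup_nonneg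
    rintro _ ⟨y, -, rfl⟩
    exact (hA y).1
  · apply Real.sSup_le _ zero_le_one
    rintro _ ⟨y, -, rfl⟩
    exact (hA y).2

theorem cut_fuzz {X : Type*} [TopologicalSpace X] [CompactSpace X] [T1Space X]
    {f : X → X} (hf : Continuous f) {g : ℝ → ℝ} (hg : Dm g) {A : X → ℝ} (hA : IsFuzzy A)
    {α : ℝ} (hα : α ∈ Ioc (0:ℝ) 1) : cut (fuzz f g A) α = f '' cut A (xiG g α) := by
  ext x
  constructor
  · intro hx
    change α ≤ sSup ((fun y => g (A y)) '' (f ⁻¹' {x})) at hx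
    have hne : (f ⁻¹' {x}).Nonempty := by
      by_contra! h
      rw [h, image_empty, Real.sSup_empty] at hx
      exact hx.not_gt hα.1
    obtain ⟨y, hy, hmax⟩ := (hA.1.upperSemicontinuousOn _).exists_isMaxOn hne
      (isClosed_singleton.preimage hf).isCompact
    refine ⟨y, (hg.xiG_le_iff hα (hA.2 y)).2 (hx.trans (csSup_le (hne.image _) ?_)), hy⟩
    rintro _ ⟨z, hz, rfl⟩
    exact hg.1 (hA.2 z) (hA.2 y) (hmax hz)
  · rintro ⟨y, hy, rfl⟩
    refine ((hg.xiG_le_iff hα (hA.2 y)).1 hy).trans (le_csSup ⟨1, ?_⟩ ⟨y, rfl, rfl⟩)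
    rintro _ ⟨z, -, rfl⟩
    exact (hg.2.2.1 (hA.2 z)).2

theorem IsFuzzy.fuzz {X : Type*} [TopologicalSpace X] [CompactSpace X] [T2Space X]
    {f : X → X} (hf : Continuous f) {g : ℝ → ℝ} (hg : Dm g) {A : X → ℝ} (hA : IsFuzzy A) :
    IsFuzzy (fuzz f g A) := by
  have hI := fuzz_mem_I01 (f := f) fun x => hg.2.2.1 (hA.2 x)
  refine ⟨upperSemicontinuous_iff_isClosed_preimage.2 fun α => ?_, hI⟩
  change IsClosed (cut (_root_.fuzz f g A) α)
  rcases le_or_gt α 0 with h0 | h0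
  · rw [show cut (_root_.fuzz f g A) α = univ from eq_univ_of_forall fun x => h0.trans (hI x).1]
    exact isClosed_univ
  rcases le_or_gt α 1 with h1 | h1
  · rw [cut_fuzz hf hg hA ⟨h0, h1⟩]
    exact ((hA.isClosed_cut _).isCompact.image hf).isClosed
  · rw [show cut (_root_.fuzz f g A) α = ∅ from
      eq_empty_of_forall_notMem fun x hx => ((hI x).2.trans_lt h1).not_ge hx]
    exact isClosed_empty

theorem IsFuzzy.iterate_fuzz {X : Type*} [TopologicalSpace X] [CompactSpace X] [T2Space X]
    {f : X → X} (hf : Continuous f) {g : ℝ → ℝ} (hg : Dm g) {A : X → ℝ} (hA : IsFuzzy A)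
    (n : ℕ) : IsFuzzy ((_root_.fuzz f g)^[n] A) := by
  induction n with
  | zero => exact hA
  | succ n ih =>
    rw [Function.iterate_succ_apply']
    exact ih.fuzz hf hg

/-- `[(f̃_g)ⁿ(A)]_α = fⁿ([A]_{ξ_gⁿ(α)})` for every `n ∈ ℕ`,
`A ∈ F(X)` and `α ∈ (0,1]`. -/
theorem stmt2 {X : Type*} [MetricSpace X] [CompactSpace X]
    (f : X → X) (hf : Continuous f) (g : ℝ → ℝ) (hg : Dm g)
    (A : X → ℝ) (hA : IsFuzzy A) (n : ℕ) (hn : 1 ≤ n)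
    (α : ℝ) (hα : α ∈ Set.Ioc (0:ℝ) 1) :
    cut ((fuzz f g)^[n] A) α = f^[n] '' cut A ((xiG g)^[n] α) := by
  clear hn
  induction n generalizing α with
  | zero => simp
  | succ n ih =>
    rw [Function.iterate_succ_apply', cut_fuzz hf hg (hA.iterate_fuzz hf hg n) hα,
      ih _ (hg.xiG_mem_Ioc hα), ← image_comp, ← Function.iterate_succ',
      Function.iterate_succ_apply (xiG g)]
end
end
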